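/- There exists a constant C > 0 such that for every T ≥ 1 and every t ≥ 0, |k_T(t)| ≤ C·e^{−T/2}. (This is the sup-norm bound ‖k_T‖_∞ ≲ e^{−T/2} of the paper's Lemma on the hyperbolic kernel.) -/

import Mathlib

open Real MeasureTheory

/-- `Q_T(ω) = 2(4ω+2)cosh(T)/((4ω+2)² − 2 + 2cosh(2T))`. -/
noncomputable def QT (T ω : ℝ) : ℝ :=
  2 * (4 * ω + 2) * Real.cosh T / ((4 * ω + 2) ^ 2 - 2 + 2 * Real.cosh (2 * T))

/-- The radial kernel with spherical transform `cos(rT)/cosh(πr/2)`: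
`k_T(t) = −(1/π) ∫_t^∞ Q_T′(ω) (ω − t)^{−1/2} dω`. -/
noncomputable def kT (T t : ℝ) : ℝ :=
  -(1 / Real.pi) * ∫ ω in Set.Ioi t, deriv (QT T) ω / Real.sqrt (ω - t)

theorem QT_eq (T ω : ℝ) :
    QT T ω = 2 * (4 * ω + 2) * cosh T / ((4 * ω + 2) ^ 2 + 4 * sinh T ^ 2) := by
  have h : cosh (2 * T) = 2 * sinh T ^ 2 + 1 := by
    rw [cosh_two_mul, cosh_sq]; ring
  rw [QT, h]
  congr 1
  ring

theorem hasDerivAt_QT {T : ℝ} (hT : 0 < T) (ω : ℝ) :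
    HasDerivAt (QT T) (8 * cosh T * (4 * sinh T ^ 2 - (4 * ω + 2) ^ 2) /
      ((4 * ω + 2) ^ 2 + 4 * sinh T ^ 2) ^ 2) ω := by
  have hs : 0 < sinh T := sinh_pos_iff.2 hT
  have hD : (4 * ω + 2) ^ 2 + 4 * sinh T ^ 2 ≠ 0 := by positivity
  have hu : HasDerivAt (fun ω : ℝ => 4 * ω + 2) 4 ω := by
    simpa using ((hasDerivAt_id ω).const_mul 4).add_const 2
  have h := ((hu.const_mul 2).mul_const (cosh T)).div ((hu.pow 2).add_const (4 * sinh T ^ 2)) hD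
  rw [funext (QT_eq T)]
  refine h.congr_deriv ?_
  norm_num
  ring

theorem abs_deriv_QT_le {T : ℝ} (hT : 0 < T) (ω : ℝ) :
    |deriv (QT T) ω| ≤ 8 * cosh T / ((4 * ω + 2) ^ 2 + 4 * sinh T ^ 2) := by
  have hs : 0 < sinh T := sinh_pos_iff.2 hT
  have hc : 0 < cosh T := cosh_pos T
  have hD : 0 < (4 * ω + 2) ^ 2 + 4 * sinh T ^ 2 := by positivity
  have habs : |4 * sinh T ^ 2 - (4 * ω + 2) ^ 2| ≤ (4 * ω + 2) ^ 2 + 4 * sinh T ^ 2 := by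
    rw [abs_le]
    constructor <;> nlinarith [sq_nonneg (sinh T), sq_nonneg (4 * ω + 2)]
  rw [(hasDerivAt_QT hT ω).deriv, abs_div, abs_mul, abs_of_pos (by positivity : 0 < 8 * cosh T),
    abs_of_pos (by positivity : 0 < ((4 * ω + 2) ^ 2 + 4 * sinh T ^ 2) ^ 2),
    div_le_div_iff₀ (by positivity) hD]
  calc 8 * cosh T * |4 * sinh T ^ 2 - (4 * ω + 2) ^ 2| * ((4 * ω + 2) ^ 2 + 4 * sinh T ^ 2)
      ≤ 8 * cosh T * ((4 * ω + 2) ^ 2 + 4 * sinh T ^ 2) *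
          ((4 * ω + 2) ^ 2 + 4 * sinh T ^ 2) := by gcongr
    _ = _ := by ring

theorem hasDerivAt_arctan_sqrt_sub_div {s t ω : ℝ} (hs : 0 < s) (hω : t < ω) :
    HasDerivAt (fun ω => arctan (√(ω - t) / √s)) (√s / (2 * (s + (ω - t)) * √(ω - t))) ω := by
  have hx : 0 < ω - t := sub_pos.2 hω
  have hsx : √(ω - t) ^ 2 = ω - t := sq_sqrt hx.le
  have hss : √s ^ 2 = s := sq_sqrt hs.le
  have h := ((((hasDerivAt_id ω).sub_const t).sqrt hx.ne').div_const √s).arctan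
  refine h.congr_deriv ?_
  simp only [id]
  have h1 : 0 < √(ω - t) := sqrt_pos.2 hx
  have h2 : 0 < √s := sqrt_pos.2 hs
  have h3 : 0 < s + (ω - t) := by positivity
  rw [div_pow, hsx, hss]
  have h4 : 1 + (ω - t) / s = (s + (ω - t)) / s := by field_simp
  rw [h4]
  field_simp
  rw [hss]

theorem integrableOn_and_integral_arctan_kernel {s : ℝ} (hs : 0 < s) (t : ℝ) :
    IntegrableOn (fun ω => √s / (2 * (s + (ω - t)) * √(ω - t))) (Set.Ioi t) ∧
      ∫ ω in Set.Ioi t, √s / (2 * (s + (ω - t)) * √(ω - t)) = π / 2 := by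
  have hcont : ContinuousWithinAt (fun ω => arctan (√(ω - t) / √s)) (Set.Ici t) t := by
    fun_prop
  have hderiv : ∀ ω ∈ Set.Ioi t, HasDerivAt (fun ω => arctan (√(ω - t) / √s))
      (√s / (2 * (s + (ω - t)) * √(ω - t))) ω :=
    fun ω hω => hasDerivAt_arctan_sqrt_sub_div hs hω
  have hnonneg : ∀ ω ∈ Set.Ioi t, 0 ≤ √s / (2 * (s + (ω - t)) * √(ω - t)) := fun ω hω => by
    have : 0 < ω - t := sub_pos.2 hω
    positivity
  have hlim : Filter.Tendsto (fun ω => arctan (√(ω - t) / √s)) Filter.atTop (nhds (π / 2)) := by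
    refine (tendsto_arctan_atTop.mono_right nhdsWithin_le_nhds).comp ?_
    exact (tendsto_sqrt_atTop.comp (Filter.tendsto_atTop_add_const_right _ (-t)
      Filter.tendsto_id)).atTop_div_const (sqrt_pos.2 hs)
  refine ⟨integrableOn_Ioi_deriv_of_nonneg hcont hderiv hnonneg hlim, ?_⟩
  rw [integral_Ioi_of_hasDerivAt_of_nonneg hcont hderiv hnonneg hlim]
  simp

theorem norm_integrand_le {T t ω : ℝ} (hT : 0 < T) (ht : 0 ≤ t) (hω : t < ω) :
    ‖deriv (QT T) ω / √(ω - t)‖ ≤ 6 * cosh T / (sinh T * √(sinh T)) *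
      (√(sinh T) / (2 * (sinh T + (ω - t)) * √(ω - t))) := by
  have hs : 0 < sinh T := sinh_pos_iff.2 hT
  have hc : 0 < cosh T := cosh_pos T
  have hx : 0 < ω - t := sub_pos.2 hω
  have h2 : 0 < √(sinh T) := sqrt_pos.2 hs
  have h1 : 0 < √(ω - t) := sqrt_pos.2 hx
  rw [norm_div, norm_eq_abs, norm_eq_abs, abs_of_pos h1]
  have hrhs : 6 * cosh T / (sinh T * √(sinh T)) *
      (√(sinh T) / (2 * (sinh T + (ω - t)) * √(ω - t))) =
      3 * cosh T / (sinh T * (sinh T + (ω - t))) / √(ω - t) := by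
    field_simp
    norm_num
  rw [hrhs]
  gcongr
  refine (abs_deriv_QT_le hT ω).trans ?_
  rw [div_le_div_iff₀ (by positivity) (by positivity)]
  have key : 8 * (sinh T * (sinh T + (ω - t))) ≤ 3 * ((4 * ω + 2) ^ 2 + 4 * sinh T ^ 2) := by
    nlinarith [sq_nonneg (sinh T - (ω - t)), mul_nonneg ht hx.le, sq_nonneg t, sq_nonneg (ω - t)]
  nlinarith [mul_le_mul_of_nonneg_left key hc.le]

theorem abs_kT_le {T t : ℝ} (hT : 0 < T) (ht : 0 ≤ t) :
    |kT T t| ≤ 3 * cosh T / (sinh T * √(sinh T)) := by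
  obtain ⟨hint, hval⟩ := integrableOn_and_integral_arctan_kernel (sinh_pos_iff.2 hT) t
  have h := norm_integral_le_of_norm_le
    (hint.const_mul (6 * cosh T / (sinh T * √(sinh T))))
    ((ae_restrict_mem measurableSet_Ioi).mono fun ω hω => norm_integrand_le hT ht hω)
  rw [integral_const_mul, hval, norm_eq_abs] at h
  have hpi := pi_pos
  rw [kT, abs_mul, abs_neg, abs_of_pos (by positivity : 0 < 1 / π)]
  refine (mul_le_mul_of_nonneg_left h (by positivity)).trans_eq ?_
  field_simp
  norm_num

theorem exp_div_four_le_sinh {T : ℝ} (hT : 1 ≤ T) : exp T / 4 ≤ sinh T := by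
  have h1 : 2 ≤ exp T := by linarith [add_one_le_exp T]
  have h2 : exp (-T) ≤ 1 := exp_le_one_iff.2 (by linarith)
  rw [sinh_eq]
  linarith

theorem cosh_le_exp {T : ℝ} (hT : 0 ≤ T) : cosh T ≤ exp T := by
  have h : exp (-T) ≤ exp T := exp_le_exp.2 (by linarith)
  rw [cosh_eq]
  linarith

/-- Sup-norm bound: for `T ≥ 1` and `t ≥ 0`, `|k_T(t)| ≤ C e^{−T/2}`. -/
theorem stmt_13 :
    ∃ C : ℝ, 0 < C ∧ ∀ T : ℝ, 1 ≤ T → ∀ t : ℝ, 0 ≤ t →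
      |kT T t| ≤ C * Real.exp (-T / 2) := by
  refine ⟨24, by norm_num, fun T hT t ht => (abs_kT_le (by linarith) ht).trans ?_⟩
  have hs := exp_div_four_le_sinh hT
  have hsqrt : exp (T / 2) / 2 ≤ √(sinh T) := by
    refine le_sqrt_of_sq_le (le_trans (le_of_eq ?_) hs)
    rw [div_pow, ← exp_nat_mul]
    norm_num
    ring_nf
  calc 3 * cosh T / (sinh T * √(sinh T))
      ≤ 3 * exp T / (exp T / 4 * (exp (T / 2) / 2)) := by
        gcongr
        exact cosh_le_exp (by linarith)
    _ = 24 * exp (-T / 2) := by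
        rw [neg_div, exp_neg]
        field_simp
        norm_num
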